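/- arXiv:1203.2959 — 2 statements merged into one kernel-verified Lean document; each statement's English description precedes it below -/
import Mathlib

section
/- Let φ ∈ [0, π], n = 2cos(φ), and let σ = (π + 3φ)/(4π) (the dilute-regime spin). Set λ = exp(−iπσ/3) and j = exp(2πi/3). Then n + λ⁴·conj(j) + conj(λ)⁴·j = 0. -/
open Real Complex

/-- Dilute-regime cancellation identity underlying Smirnov's preholomorphicity lemma:
with `n = 2 cos φ`, `σ = (π + 3φ)/(4π)`, `λ = exp(-iπσ/3)` and `j = exp(2πi/3)`,
one has `n + λ⁴ conj(j) + conj(λ)⁴ j = 0`. -/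
theorem dilute_cancellation (φ : ℝ) (hφ : φ ∈ Set.Icc 0 π)
    (n : ℝ) (hn : n = 2 * Real.cos φ)
    (σ : ℝ) (hσ : σ = (π + 3 * φ) / (4 * π))
    (lam j : ℂ)
    (hlam : lam = Complex.exp (-(Complex.I * (π : ℂ) * (σ : ℂ)) / 3))
    (hj : j = Complex.exp (2 * (π : ℂ) * Complex.I / 3)) :
    (n : ℂ) + lam ^ 4 * (starRingEnd ℂ) j + ((starRingEnd ℂ) lam) ^ 4 * j = 0 := by
  have hpi : (π : ℂ) ≠ 0 := by exact_mod_cast Real.pi_ne_zero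
  have h1 : lam ^ 4 * (starRingEnd ℂ) j = -Complex.exp (-(φ : ℂ) * Complex.I) := by
    have e : ((4 : ℕ) : ℂ) * (-(Complex.I * (π : ℂ) * (σ : ℂ)) / 3)
        + (starRingEnd ℂ) (2 * (π : ℂ) * Complex.I / 3)
        = -(φ : ℂ) * Complex.I - (π : ℂ) * Complex.I := by
      rw [hσ]
      simp only [map_mul, map_div₀, Complex.conj_I, Complex.conj_ofReal, map_ofNat]
      push_cast
      field_simp
      ring
    rw [hlam, hj, ← Complex.exp_conj, ← Complex.exp_nat_mul, ← Complex.exp_add, e,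
      Complex.exp_sub, Complex.exp_pi_mul_I]
    ring
  have h2 : ((starRingEnd ℂ) lam) ^ 4 * j = -Complex.exp ((φ : ℂ) * Complex.I) := by
    have h := congrArg (starRingEnd ℂ) h1
    simpa [← Complex.exp_conj] using h
  rw [h1, h2, hn]
  push_cast
  rw [Complex.two_cos]
  ring
end

section
/- Let φ ∈ [0, π], n = 2cos(φ), and let σ = (π − 3φ)/(4π) (the dense-regime spin). Set λ = exp(−iπσ/3) and j = exp(2πi/3). Then n + λ⁴·conj(j) + conj(λ)⁴·j = 0. -/
open Real Complex

/-- Dense-regime cancellation identity underlying Smirnov's preholomorphicity lemma: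
with `n = 2 cos φ`, `σ = (π - 3φ)/(4π)`, `λ = exp(-iπσ/3)` and `j = exp(2πi/3)`,
one has `n + λ⁴ conj(j) + conj(λ)⁴ j = 0`. -/
theorem dense_cancellation (φ : ℝ) (hφ : φ ∈ Set.Icc 0 π)
    (n : ℝ) (hn : n = 2 * Real.cos φ)
    (σ : ℝ) (hσ : σ = (π - 3 * φ) / (4 * π))
    (lam j : ℂ)
    (hlam : lam = Complex.exp (-(Complex.I * (π : ℂ) * (σ : ℂ)) / 3))
    (hj : j = Complex.exp (2 * (π : ℂ) * Complex.I / 3)) :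
    (n : ℂ) + lam ^ 4 * (starRingEnd ℂ) j + ((starRingEnd ℂ) lam) ^ 4 * j = 0 := by
  have hpi : (π : ℂ) ≠ 0 := by exact_mod_cast Real.pi_ne_zero
  have h1 : lam ^ 4 * (starRingEnd ℂ) j = -Complex.exp (φ * Complex.I) := by
    have e : (4 : ℕ) * (-(Complex.I * (π : ℂ) * (σ : ℂ)) / 3)
        + (starRingEnd ℂ) (2 * (π : ℂ) * Complex.I / 3)
        = φ * Complex.I - π * Complex.I := by
      rw [hσ]
      simp only [map_div₀, map_mul, Complex.conj_I, Complex.conj_ofReal, map_ofNat]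
      push_cast
      field_simp
      ring
    rw [hlam, hj, ← Complex.exp_conj, ← Complex.exp_nat_mul, ← Complex.exp_add, e,
      Complex.exp_sub, Complex.exp_pi_mul_I]
    ring
  have h2 : ((starRingEnd ℂ) lam) ^ 4 * j = -Complex.exp (-φ * Complex.I) := by
    have h := congrArg (starRingEnd ℂ) h1
    rw [map_mul, map_pow, Complex.conj_conj, map_neg, ← Complex.exp_conj, map_mul,
      Complex.conj_ofReal, Complex.conj_I] at h
    rw [h]
    congr 2
    ring
  rw [h1, h2, hn]
  push_cast
  rw [Complex.two_cos]
  ring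
end
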